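/- (Shapes of compliant contracts.) If ρ ⫤ σ, then one of the following four conditions holds: (1) ρ = 1; (2) ρ = Σ_{i∈I} α_i.ρ_i and σ = Σ_{j∈J} ᾱ_j.σ_j (both retractable sums) and there exists k ∈ I ∩ J with ρ_k ⫤ σ_k; (3) ρ = ⊕_{i∈I} ā_i.ρ_i, σ = Σ_{j∈J} a_j.σ_j, I ⊆ J, and ρ_k ⫤ σ_k for all k ∈ I; (4) ρ = Σ_{i∈I} a_i.ρ_i, σ = ⊕_{j∈J} ā_j.σ_j, J ⊆ I, and ρ_k ⫤ σ_k for all k ∈ J. -/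

import Mathlib

/-! Retractable contracts (Barbanera, Dezani-Ciancaglini, Lanese, de'Liguoro,
"Retractable Contracts"). -/

/-- Retractable contract expressions, with de Bruijn indices for recursion.
`ext true l` is a retractable input sum `Σ aᵢ.σᵢ`, `ext false l` a retractable
output sum `Σ āᵢ.σᵢ`, and `intSum l` an unretractable output choice `⊕ āᵢ.σᵢ`. -/
inductive RC : Type
  | one : RC
  | ext : Bool → List (ℕ × RC) → RC
  | intSum : List (ℕ × RC) → RC
  | var : ℕ → RC
  | mu : RC → RC

namespace RC

/-- Substitution of the (closed) term `u` for variable `k`. -/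
def subst (t : RC) (k : ℕ) (u : RC) : RC :=
  match t with
  | .one => .one
  | .var n => if n = k then u else .var n
  | .mu σ => .mu (subst σ (k+1) u)
  | .ext p l => .ext p (l.attach.map fun x => (x.1.1, subst x.1.2 k u))
  | .intSum l => .intSum (l.attach.map fun x => (x.1.1, subst x.1.2 k u))
termination_by sizeOf t
decreasing_by
  all_goals simp_wf
  all_goals first
    | omega
    | (obtain ⟨⟨a, s⟩, hx⟩ := x
       have h := List.sizeOf_lt_of_mem hx
       simp [Prod.mk.sizeOf_spec] at h ⊢
       omega)

/-- One-step unfolding of the recursive contract `mu σ`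
(`rec x.σ` is equated with `σ[rec x.σ / x]`). -/
def unf (σ : RC) : RC := subst σ 0 (.mu σ)

/-- Well-formedness: `WFa n σ` means all free variables of `σ` are below `n`,
all sums are non-empty with pairwise distinct names, and recursion is guarded
(the body of a recursion is not a variable). -/
inductive WFa : ℕ → RC → Prop
  | one : ∀ n, WFa n .one
  | var : ∀ n m, m < n → WFa n (.var m)
  | ext : ∀ (n : ℕ) (p : Bool) (l : List (ℕ × RC)), l ≠ [] → (l.map Prod.fst).Nodup →
      (∀ x ∈ l, WFa n x.2) → WFa n (.ext p l)
  | intSum : ∀ (n : ℕ) (l : List (ℕ × RC)), l ≠ [] → (l.map Prod.fst).Nodup →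
      (∀ x ∈ l, WFa n x.2) → WFa n (.intSum l)
  | mu : ∀ (n : ℕ) (σ : RC), (∀ m, σ ≠ .var m) → WFa (n+1) σ → WFa n (.mu σ)

end RC

/-- A retractable contract: a closed well-formed expression. -/
def WF (σ : RC) : Prop := RC.WFa 0 σ

/-- Head unfolding: `Unf ρ τ` holds when repeatedly unfolding top-level
recursion in `ρ` yields `τ` (equi-recursive view of recursion). -/
inductive Unf : RC → RC → Prop
  | one : Unf .one .one
  | ext : ∀ p l, Unf (.ext p l) (.ext p l)
  | intSum : ∀ l, Unf (.intSum l) (.intSum l)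
  | var : ∀ n, Unf (.var n) (.var n)
  | mu : ∀ σ τ, Unf (RC.unf σ) τ → Unf (.mu σ) τ

/-- Actions of the LTS: `act true a` is the input `a`, `act false a` is the
output `ā`; `tau` is the internal action; `rb` is rollback. -/
inductive Act : Type
  | act : Bool → ℕ → Act
  | tau : Act
  | rb : Act

/-- Histories (stacks); the head of the list is the top of the stack.
`none` is the placeholder `∘` (no remaining alternatives). -/
abbrev Hist := List (Option RC)

/-- The sum of the remaining branches of a retractable sum, or `∘` if no
branch remains. -/
def restOf (p : Bool) (l : List (ℕ × RC)) : Option RC :=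
  match l with
  | [] => none
  | _ => some (.ext p l)

/-- LTS of contracts with histories: rules (+)/(α) (`ext`, `intOut`), (⊕)
(`intTau`), (rb) (`rb`), plus transparent unfolding of recursion (`mu`). -/
inductive Step : Hist → Option RC → Act → Hist → Option RC → Prop
  | ext : ∀ (γ : Hist) (p : Bool) (l₁ l₂ : List (ℕ × RC)) (a : ℕ) (σ : RC),
      Step γ (some (.ext p (l₁ ++ (a, σ) :: l₂))) (.act p a)
        (restOf p (l₁ ++ l₂) :: γ) (some σ)
  | intTau : ∀ (γ : Hist) (l : List (ℕ × RC)) (a : ℕ) (σ : RC),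
      (a, σ) ∈ l → 2 ≤ l.length →
      Step γ (some (.intSum l)) .tau γ (some (.intSum [(a, σ)]))
  | intOut : ∀ (γ : Hist) (a : ℕ) (σ : RC),
      Step γ (some (.intSum [(a, σ)])) (.act false a) (none :: γ) (some σ)
  | rb : ∀ (γ : Hist) (σ' ρ : Option RC),
      Step (σ' :: γ) ρ .rb γ σ'
  | mu : ∀ (γ : Hist) (σ : RC) (α : Act) (δ : Hist) (ρ : Option RC),
      Step γ (some (RC.unf σ)) α δ ρ → Step γ (some (.mu σ)) α δ ρ

/-- Client/server configurations `⟨cH⟩c ∥ ⟨sH⟩s`. -/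
structure Conf : Type where
  cH : Hist
  c  : Option RC
  sH : Hist
  s  : Option RC

/-- Forward reduction of client/server pairs: rules (comm) and (τ). -/
inductive FRed : Conf → Conf → Prop
  | comm : ∀ (δ δ' γ γ' : Hist) (ρ ρ' σ σ' : Option RC) (p : Bool) (a : ℕ),
      Step δ ρ (.act p a) δ' ρ' → Step γ σ (.act (!p) a) γ' σ' →
      FRed ⟨δ, ρ, γ, σ⟩ ⟨δ', ρ', γ', σ'⟩
  | tauL : ∀ (δ δ' γ : Hist) (ρ ρ' σ : Option RC),
      Step δ ρ .tau δ' ρ' → FRed ⟨δ, ρ, γ, σ⟩ ⟨δ', ρ', γ, σ⟩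
  | tauR : ∀ (δ γ γ' : Hist) (ρ σ σ' : Option RC),
      Step γ σ .tau γ' σ' → FRed ⟨δ, ρ, γ, σ⟩ ⟨δ, ρ, γ', σ'⟩

/-- Reduction of client/server pairs: forward steps, plus the rule (rbk),
applicable only when the client is not `1` and no forward step is possible. -/
inductive Red : Conf → Conf → Prop
  | fwd : ∀ c c', FRed c c' → Red c c'
  | rbk : ∀ (δ δ' γ γ' : Hist) (ρ ρ' σ σ' : Option RC),
      ρ ≠ some .one → (∀ d, ¬ FRed ⟨δ, ρ, γ, σ⟩ d) →
      Step δ ρ .rb δ' ρ' → Step γ σ .rb γ' σ' →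
      Red ⟨δ, ρ, γ, σ⟩ ⟨δ', ρ', γ', σ'⟩

/-- Multi-step reduction of client/server pairs. -/
def Reds : Conf → Conf → Prop := Relation.ReflTransGen Red

/-- A configuration admitting no reduction. -/
def Stuck (c : Conf) : Prop := ∀ c', ¬ Red c c'

/-- A rollback step of a client/server pair (an instance of rule (rbk)). -/
def RbkStep (c c' : Conf) : Prop :=
  c.c ≠ some RC.one ∧ (∀ d, ¬ FRed c d) ∧
  Step c.cH c.c .rb c'.cH c'.c ∧ Step c.sH c.s .rb c'.sH c'.s

/-- Compliance of contracts with histories: every reachable stuck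
configuration has client `1`. -/
def CompliantCH (δ : Hist) (ρ : Option RC) (γ : Hist) (σ : Option RC) : Prop :=
  ∀ c' : Conf, Reds ⟨δ, ρ, γ, σ⟩ c' → Stuck c' → c'.c = some RC.one

/-- Compliance of contracts: `ρ ⫤ σ`. -/
def Compliant (ρ σ : RC) : Prop := CompliantCH [] (some ρ) [] (some σ)

/-- The formal system for compliance: `Derives Γ ρ σ` is the judgment
`Γ ▷ ρ ⊣ σ`, with rules (Ax), (Hyp), (+,+), (⊕,+), (+,⊕), and rules
realising the equi-recursive identification `rec x.σ = σ[rec x.σ/x]`. -/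
inductive Derives : List (RC × RC) → RC → RC → Prop
  | ax : ∀ Γ σ, Derives Γ .one σ
  | hyp : ∀ Γ ρ σ, (ρ, σ) ∈ Γ → Derives Γ ρ σ
  | plusPlus : ∀ (Γ : List (RC × RC)) (p : Bool) (lρ lσ : List (ℕ × RC)) (a : ℕ) (ρk σk : RC),
      (a, ρk) ∈ lρ → (a, σk) ∈ lσ →
      Derives ((RC.ext p lρ, RC.ext (!p) lσ) :: Γ) ρk σk →
      Derives Γ (.ext p lρ) (.ext (!p) lσ)
  | oplusPlus : ∀ (Γ : List (RC × RC)) (lρ lσ : List (ℕ × RC)),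
      (∀ x ∈ lρ, x.1 ∈ lσ.map Prod.fst) →
      (∀ (a : ℕ) (ρi σi : RC), (a, ρi) ∈ lρ → (a, σi) ∈ lσ →
        Derives ((RC.intSum lρ, RC.ext true lσ) :: Γ) ρi σi) →
      Derives Γ (.intSum lρ) (.ext true lσ)
  | plusOplus : ∀ (Γ : List (RC × RC)) (lρ lσ : List (ℕ × RC)),
      (∀ x ∈ lσ, x.1 ∈ lρ.map Prod.fst) →
      (∀ (a : ℕ) (ρj σj : RC), (a, ρj) ∈ lρ → (a, σj) ∈ lσ →
        Derives ((RC.ext true lρ, RC.intSum lσ) :: Γ) ρj σj) →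
      Derives Γ (.ext true lρ) (.intSum lσ)
  | unfoldL : ∀ (Γ : List (RC × RC)) (σ τ : RC),
      Derives Γ (RC.unf σ) τ → Derives Γ (.mu σ) τ
  | unfoldR : ∀ (Γ : List (RC × RC)) (ρ σ : RC),
      Derives Γ ρ (RC.unf σ) → Derives Γ ρ (.mu σ)

/-! ### Head unfolding of well-formed contracts -/

namespace RC

theorem subst_ext (p : Bool) (l : List (ℕ × RC)) (k : ℕ) (u : RC) :
    subst (.ext p l) k u = .ext p (l.map fun x => (x.1, subst x.2 k u)) := by
  simp only [subst, List.map_attach_eq_pmap, List.pmap_eq_map]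

theorem subst_intSum (l : List (ℕ × RC)) (k : ℕ) (u : RC) :
    subst (.intSum l) k u = .intSum (l.map fun x => (x.1, subst x.2 k u)) := by
  simp only [subst, List.map_attach_eq_pmap, List.pmap_eq_map]

theorem WFa.mono {n m : ℕ} {t : RC} (h : WFa n t) (hnm : n ≤ m) : WFa m t := by
  induction h generalizing m with
  | one => exact .one _
  | var n k hk => exact .var _ _ (by omega)
  | ext n p l hne hnd _ ih => exact .ext _ _ _ hne hnd fun x hx => ih x hx hnm
  | intSum n l hne hnd _ ih => exact .intSum _ _ hne hnd fun x hx => ih x hx hnm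
  | mu n σ hσ _ ih => exact .mu _ _ hσ (ih (by omega))

theorem subst_ne_var {t : RC} (ht : ∀ m, t ≠ .var m) (k : ℕ) (u : RC) (m : ℕ) :
    subst t k u ≠ .var m := by
  cases t with
  | var n => exact absurd rfl (ht n)
  | one => simp [subst]
  | mu => simp [subst]
  | ext => simp [subst]
  | intSum => simp [subst]

theorem WFa.subst {n : ℕ} {t u : RC} (h : WFa (n + 1) t) (hu : WFa 0 u) :
    WFa n (t.subst n u) := by
  generalize hN : n + 1 = N at h
  induction h generalizing n with
  | one => rw [RC.subst]; exact .one _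
  | var N k hk =>
    rw [RC.subst]
    split
    · exact hu.mono (Nat.zero_le _)
    · exact .var _ _ (by omega)
  | ext N p l hne hnd _ ih =>
    rw [subst_ext]
    refine .ext _ _ _ (by simpa using hne) (by simpa [Function.comp_def] using hnd) fun x hx => ?_
    obtain ⟨y, hy, rfl⟩ := List.mem_map.1 hx
    exact ih y hy hN
  | intSum N l hne hnd _ ih =>
    rw [subst_intSum]
    refine .intSum _ _ (by simpa using hne) (by simpa [Function.comp_def] using hnd) fun x hx => ?_
    obtain ⟨y, hy, rfl⟩ := List.mem_map.1 hx
    exact ih y hy hN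
  | mu N σ hσ _ ih =>
    rw [RC.subst]
    exact .mu _ _ (subst_ne_var hσ _ _) (ih (by omega))

/-- The number of leading recursion binders. -/
def muDepth : RC → ℕ
  | .mu σ => muDepth σ + 1
  | _ => 0

theorem WFa.muDepth_subst {n : ℕ} {t : RC} (h : WFa n t) (ht : ∀ m, t ≠ .var m) (k : ℕ) (u : RC) :
    (t.subst k u).muDepth = t.muDepth := by
  induction h generalizing k with
  | one => simp [RC.subst]
  | var n m => exact absurd rfl (ht m)
  | ext => simp [subst_ext, muDepth]
  | intSum => simp [subst_intSum, muDepth]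
  | mu n σ hσ _ ih => simp [RC.subst, muDepth, ih hσ]

end RC

theorem WF.exists_unf {ρ : RC} (hρ : WF ρ) :
    Unf ρ .one ∨ (∃ p l, l ≠ [] ∧ Unf ρ (.ext p l)) ∨ ∃ l, l ≠ [] ∧ Unf ρ (.intSum l) := by
  generalize hd : ρ.muDepth = d
  induction d generalizing ρ with
  | zero =>
    cases hρ with
    | one => exact .inl .one
    | var _ _ h => omega
    | ext _ p l hne => exact .inr (.inl ⟨p, l, hne, .ext p l⟩)
    | intSum _ l hne => exact .inr (.inr ⟨l, hne, .intSum l⟩)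
    | mu => simp [RC.muDepth] at hd
  | succ d ih =>
    cases hρ with
    | mu _ σ hσ hwf =>
      have hunf : WF (RC.unf σ) := RC.WFa.subst hwf (.mu _ _ hσ hwf)
      have hdepth : (RC.unf σ).muDepth = d := by
        rw [RC.unf, hwf.muDepth_subst hσ]
        simpa [RC.muDepth] using hd
      rcases ih hunf hdepth with h | ⟨p, l, hne, h⟩ | ⟨l, hne, h⟩
      · exact .inl (.mu _ _ h)
      · exact .inr (.inl ⟨p, l, hne, .mu _ _ h⟩)
      · exact .inr (.inr ⟨l, hne, .mu _ _ h⟩)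
    | _ => simp [RC.muDepth] at hd

/-! ### Transitions up to unfolding -/

/-- Two contracts (or placeholders) have exactly the same transitions. -/
def SameSteps (x y : Option RC) : Prop :=
  ∀ γ α δ ρ, Step γ x α δ ρ ↔ Step γ y α δ ρ

theorem Unf.sameSteps {ρ τ : RC} (h : Unf ρ τ) : SameSteps (some ρ) (some τ) := by
  induction h with
  | mu σ τ _ ih =>
    intro γ α δ ρ
    rw [← ih]
    refine ⟨fun h => ?_, .mu _ _ _ _ _⟩
    cases h with
    | rb => exact .rb _ _ _
    | mu _ _ _ _ _ h => exact h
  | _ => exact fun _ _ _ _ => Iff.rfl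

theorem sameSteps_restOf (p : Bool) (l : List (ℕ × RC)) :
    SameSteps (restOf p l) (some (.ext p l)) := by
  cases l with
  | cons x l => exact fun _ _ _ _ => Iff.rfl
  | nil =>
    intro γ α δ ρ
    constructor
    · intro h
      cases h
      exact .rb _ _ _
    · intro h
      generalize hx : some (RC.ext p []) = x at h
      cases h with
      | rb => exact .rb _ _ _
      | _ => simp at hx

theorem restOf_ne_one (p : Bool) (l : List (ℕ × RC)) : restOf p l ≠ some .one := by
  cases l <;> simp [restOf]

theorem step_ext_of_mem {γ : Hist} (p : Bool) {l : List (ℕ × RC)} {a : ℕ} {σ : RC}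
    (h : (a, σ) ∈ l) : ∃ l', l'.length < l.length ∧ l' ⊆ l ∧
      Step γ (some (.ext p l)) (.act p a) (restOf p l' :: γ) (some σ) := by
  obtain ⟨l₁, l₂, rfl⟩ := List.append_of_mem h
  refine ⟨l₁ ++ l₂, by simp, ?_, .ext _ _ _ _ _ _⟩
  intro x hx
  simp only [List.mem_append, List.mem_cons] at hx ⊢
  tauto

theorem Step.act_of_ext {γ δ : Hist} {p q : Bool} {l : List (ℕ × RC)} {a : ℕ} {ρ : Option RC}
    (h : Step γ (some (.ext p l)) (.act q a) δ ρ) : q = p ∧ ∃ σ, (a, σ) ∈ l := by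
  cases h with
  | ext _ _ l₁ l₂ _ σ => exact ⟨rfl, σ, by simp⟩

theorem Step.act_of_intSum_singleton {γ δ : Hist} {q : Bool} {x : ℕ × RC} {a : ℕ} {ρ : Option RC}
    (h : Step γ (some (.intSum [x])) (.act q a) δ ρ) : q = false ∧ a = x.1 := by
  cases h
  exact ⟨rfl, rfl⟩

/-- No internal step is possible with the empty history. -/
def Silent (x : Option RC) : Prop := ∀ δ ρ, ¬ Step [] x .tau δ ρ

theorem SameSteps.silent {x y : Option RC} (h : SameSteps x y) (hy : Silent y) : Silent x :=
  fun δ ρ hs => hy δ ρ ((h _ _ _ _).1 hs)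

theorem silent_none : Silent none := fun _ _ h => nomatch h

theorem silent_one : Silent (some .one) := fun _ _ h => nomatch h

theorem silent_ext (p : Bool) (l : List (ℕ × RC)) : Silent (some (.ext p l)) :=
  fun _ _ h => nomatch h

theorem silent_intSum_singleton (x : ℕ × RC) : Silent (some (.intSum [x])) := by
  intro _ _ h
  cases h with
  | intTau _ _ _ _ _ hl => simp at hl

/-- An unretractable choice can commit to any of its branches. -/
theorem Unf.exists_commit {σ : RC} {l : List (ℕ × RC)} (h : Unf σ (.intSum l)) {x : ℕ × RC}
    (hx : x ∈ l) : ∃ y, y ≠ some RC.one ∧ SameSteps y (some (.intSum [x])) ∧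
      (y = some σ ∨ Step [] (some σ) .tau [] y) := by
  rcases Nat.lt_or_ge l.length 2 with hl | hl
  · have hlx : l = [x] := by
      obtain ⟨l₁, l₂, rfl⟩ := List.append_of_mem hx
      simp at hl
      have h₁ : l₁ = [] := List.length_eq_zero_iff.1 (by omega)
      have h₂ : l₂ = [] := List.length_eq_zero_iff.1 (by omega)
      simp [h₁, h₂]
    subst hlx
    refine ⟨some σ, ?_, h.sameSteps, .inl rfl⟩
    intro hone
    cases hone
    cases h
  · exact ⟨some (.intSum [x]), by simp, fun _ _ _ _ => Iff.rfl,
      .inr ((h.sameSteps _ _ _ _).2 (.intTau _ _ x.1 x.2 hx hl))⟩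

/-! ### Adding history below a computation -/

theorem Step.append {γ δ : Hist} {x y : Option RC} {α : Act} (h : Step γ x α δ y) (η : Hist) :
    Step (γ ++ η) x α (δ ++ η) y := by
  induction h with
  | ext => exact .ext _ _ _ _ _ _
  | intTau γ l a σ hm hl => exact .intTau _ _ _ _ hm hl
  | intOut => exact .intOut _ _ _
  | rb => exact .rb _ _ _
  | mu γ σ α δ ρ _ ih => exact .mu _ _ _ _ _ ih

theorem Step.hist_of_tau {γ δ : Hist} {x y : Option RC} (h : Step γ x .tau δ y) : δ = γ := by
  generalize hα : Act.tau = α at h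
  induction h with
  | intTau => rfl
  | mu γ σ α δ ρ _ ih => exact ih hα
  | _ => cases hα

theorem Step.hist_of_act {γ δ : Hist} {x y : Option RC} {p : Bool} {a : ℕ}
    (h : Step γ x (.act p a) δ y) : ∃ z, δ = z :: γ := by
  generalize hα : Act.act p a = α at h
  induction h with
  | ext => exact ⟨_, rfl⟩
  | intOut => exact ⟨_, rfl⟩
  | mu γ σ α δ ρ _ ih => exact ih hα
  | _ => cases hα

theorem Step.hist_of_rb {γ δ : Hist} {x y : Option RC} (h : Step γ x .rb δ y) : γ = y :: δ := by
  generalize hα : Act.rb = α at h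
  induction h with
  | rb => rfl
  | mu γ σ α δ ρ _ ih => exact ih hα
  | _ => cases hα

/-- The current state of a contract determines its forward steps, whatever the history. -/
theorem Step.change_hist {γ δ : Hist} {x y : Option RC} {α : Act} (h : Step γ x α δ y)
    (hα : α ≠ .rb) (η : Hist) : ∃ δ', Step η x α δ' y := by
  induction h with
  | ext => exact ⟨_, .ext _ _ _ _ _ _⟩
  | intTau γ l a σ hm hl => exact ⟨_, .intTau _ _ _ _ hm hl⟩
  | intOut => exact ⟨_, .intOut _ _ _⟩
  | rb => exact absurd rfl hα
  | mu γ σ α δ ρ _ ih =>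
    obtain ⟨δ', h⟩ := ih hα
    exact ⟨δ', .mu _ _ _ _ _ h⟩

theorem FRed.change_hist {δ γ δ' γ' : Hist} {x y : Option RC} {d : Conf}
    (h : FRed ⟨δ, x, γ, y⟩ d) : ∃ d, FRed ⟨δ', x, γ', y⟩ d := by
  cases h with
  | comm _ _ _ _ _ _ _ _ p a h₁ h₂ =>
    obtain ⟨_, h₁⟩ := h₁.change_hist (by simp) δ'
    obtain ⟨_, h₂⟩ := h₂.change_hist (by simp) γ'
    exact ⟨_, .comm _ _ _ _ _ _ _ _ _ _ h₁ h₂⟩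
  | tauL _ _ _ _ _ _ h =>
    obtain ⟨_, h⟩ := h.change_hist (by simp) δ'
    exact ⟨_, .tauL _ _ _ _ _ _ h⟩
  | tauR _ _ _ _ _ _ h =>
    obtain ⟨_, h⟩ := h.change_hist (by simp) γ'
    exact ⟨_, .tauR _ _ _ _ _ _ h⟩

/-- Extend both histories of a configuration at the bottom. -/
def Conf.below (c : Conf) (δ γ : Hist) : Conf := ⟨c.cH ++ δ, c.c, c.sH ++ γ, c.s⟩

theorem Red.below {c d : Conf} (h : Red c d) (δ γ : Hist) : Red (c.below δ γ) (d.below δ γ) := by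
  cases h with
  | fwd _ _ h =>
    refine .fwd _ _ ?_
    cases h with
    | comm _ _ _ _ _ _ _ _ p a h₁ h₂ =>
      exact .comm _ _ _ _ _ _ _ _ _ _ (h₁.append δ) (h₂.append γ)
    | tauL _ _ _ _ _ _ h => exact .tauL _ _ _ _ _ _ (h.append δ)
    | tauR _ _ _ _ _ _ h => exact .tauR _ _ _ _ _ _ (h.append γ)
  | rbk _ _ _ _ _ _ _ _ hne hno h₁ h₂ =>
    refine .rbk _ _ _ _ _ _ _ _ hne (fun d hd => ?_) (h₁.append δ) (h₂.append γ)
    obtain ⟨d', hd'⟩ := FRed.change_hist hd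
    exact hno d' hd'

theorem Reds.below {c d : Conf} (h : Reds c d) (δ γ : Hist) :
    Reds (c.below δ γ) (d.below δ γ) :=
  Relation.ReflTransGen.lift (fun c : Conf => c.below δ γ) (fun _ _ h => Red.below h δ γ) _ _ h

theorem Red.length_eq {c d : Conf} (h : Red c d) (hc : c.cH.length = c.sH.length) :
    d.cH.length = d.sH.length := by
  cases h with
  | fwd _ _ h =>
    cases h with
    | comm _ _ _ _ _ _ _ _ p a h₁ h₂ =>
      obtain ⟨_, rfl⟩ := h₁.hist_of_act
      obtain ⟨_, rfl⟩ := h₂.hist_of_act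
      simpa using hc
    | tauL _ _ _ _ _ _ h =>
      cases h.hist_of_tau
      exact hc
    | tauR _ _ _ _ _ _ h =>
      cases h.hist_of_tau
      exact hc
  | rbk _ _ _ _ _ _ _ _ hne hno h₁ h₂ =>
    cases h₁.hist_of_rb
    cases h₂.hist_of_rb
    simpa using hc

theorem Reds.length_eq {c d : Conf} (h : Reds c d) (hc : c.cH.length = c.sH.length) :
    d.cH.length = d.sH.length := by
  induction h with
  | refl => exact hc
  | tail _ h ih => exact h.length_eq ih

/-! ### Compliance -/

theorem CompliantCH.of_reds {δ δ' γ γ' : Hist} {x x' y y' : Option RC}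
    (h : CompliantCH δ x γ y) (hr : Reds ⟨δ, x, γ, y⟩ ⟨δ', x', γ', y'⟩) :
    CompliantCH δ' x' γ' y' :=
  fun c hc hs => h c (hr.trans hc) hs

theorem CompliantCH.of_fRed {δ δ' γ γ' : Hist} {x x' y y' : Option RC}
    (h : CompliantCH δ x γ y) (hr : FRed ⟨δ, x, γ, y⟩ ⟨δ', x', γ', y'⟩) :
    CompliantCH δ' x' γ' y' :=
  h.of_reds (.single (.fwd _ _ hr))

/-- A failing computation eventually rolls back to the top of the histories. -/
theorem reds_of_not_compliant {ρ σ : RC} (h : ¬ Compliant ρ σ) (x y : Option RC) (δ γ : Hist) :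
    Reds ⟨x :: δ, some ρ, y :: γ, some σ⟩ ⟨δ, x, γ, y⟩ := by
  simp only [Compliant, CompliantCH, not_forall] at h
  obtain ⟨⟨cH, c, sH, s⟩, hr, hs, hne⟩ := h
  have hlen : cH.length = sH.length := hr.length_eq rfl
  have hno : ∀ d, ¬ FRed ⟨cH, c, sH, s⟩ d := fun d hd => hs d (.fwd _ _ hd)
  cases cH with
  | cons u cH =>
    cases sH with
    | nil => simp at hlen
    | cons v sH =>
      exact absurd (.rbk _ _ _ _ _ _ _ _ hne hno (.rb _ _ _) (.rb _ _ _)) (hs ⟨cH, u, sH, v⟩)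
  | nil =>
    cases sH with
    | cons v sH => simp at hlen
    | nil =>
      refine (hr.below (x :: δ) (y :: γ)).tail
        (.rbk _ _ _ _ _ _ _ _ hne (fun d hd => ?_) (.rb _ _ _) (.rb _ _ _))
      obtain ⟨d', hd'⟩ := FRed.change_hist hd
      exact hno d' hd'

theorem CompliantCH.compliant_or {x y : Option RC} {δ γ : Hist} {ρ σ : RC}
    (h : CompliantCH (x :: δ) (some ρ) (y :: γ) (some σ)) :
    Compliant ρ σ ∨ CompliantCH δ x γ y := by
  by_cases hc : Compliant ρ σ
  · exact .inl hc
  · exact .inr (h.of_reds (reds_of_not_compliant hc x y δ γ))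

/-- A compliant pair that is not successful and has no internal steps can synchronise. -/
theorem CompliantCH.exists_sync {x y : Option RC} (h : CompliantCH [] x [] y)
    (hx : x ≠ some .one) (hsx : Silent x) (hsy : Silent y) :
    ∃ p a δ γ x' y', Step [] x (.act p a) δ x' ∧ Step [] y (.act (!p) a) γ y' := by
  by_contra hno
  refine hx (h ⟨[], x, [], y⟩ .refl fun c hc => ?_)
  cases hc with
  | fwd _ _ hc =>
    cases hc with
    | comm _ _ _ _ _ _ _ _ p a h₁ h₂ => exact hno ⟨_, _, _, _, _, _, h₁, h₂⟩
    | tauL _ _ _ _ _ _ h => exact hsx _ _ h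
    | tauR _ _ _ _ _ _ h => exact hsy _ _ h
  | rbk _ _ _ _ _ _ _ _ _ _ h₁ _ => exact absurd h₁.hist_of_rb (by simp)

theorem not_compliantCH_none_left {y : Option RC} (hy : Silent y) :
    ¬ CompliantCH [] none [] y := by
  intro h
  obtain ⟨_, _, _, _, _, _, h₁, _⟩ := h.exists_sync (by simp) silent_none hy
  cases h₁

theorem not_compliantCH_none_right {x : Option RC} (hx : x ≠ some .one) (hsx : Silent x) :
    ¬ CompliantCH [] x [] none := by
  intro h
  obtain ⟨_, _, _, _, _, _, _, h₂⟩ := h.exists_sync hx hsx silent_none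
  cases h₂

theorem CompliantCH.sync_retractable {p q : Bool} {l l' : List (ℕ × RC)} {x y : Option RC}
    (h : CompliantCH [] x [] y) (hx : x ≠ some .one) (hxl : SameSteps x (some (.ext p l)))
    (hyl : SameSteps y (some (.ext q l'))) :
    q = !p ∧ ∃ a ρ σ, (a, ρ) ∈ l ∧ (a, σ) ∈ l' ∧ Compliant ρ σ := by
  generalize hn : l.length = n
  induction n using Nat.strong_induction_on generalizing x y l l' with
  | _ n ih =>
    obtain ⟨r, a, _, _, _, _, h₁, h₂⟩ :=
      h.exists_sync hx (hxl.silent (silent_ext _ _)) (hyl.silent (silent_ext _ _))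
    obtain ⟨rfl, ρ, hρ⟩ := ((hxl _ _ _ _).1 h₁).act_of_ext
    obtain ⟨rfl, σ, hσ⟩ := ((hyl _ _ _ _).1 h₂).act_of_ext
    obtain ⟨k, hk, hkl, h₁⟩ := step_ext_of_mem (γ := []) r hρ
    obtain ⟨k', -, hkl', h₂⟩ := step_ext_of_mem (γ := []) (!r) hσ
    have hc := h.of_fRed (.comm _ _ _ _ _ _ _ _ _ _ ((hxl _ _ _ _).2 h₁) ((hyl _ _ _ _).2 h₂))
    rcases hc.compliant_or with hc | hc
    · exact ⟨rfl, a, ρ, σ, hρ, hσ, hc⟩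
    · obtain ⟨-, a, ρ, σ, hρ, hσ, hc⟩ := ih _ (hn ▸ hk) hc (restOf_ne_one _ _)
        (sameSteps_restOf _ _) (sameSteps_restOf _ _) rfl
      exact ⟨rfl, a, ρ, σ, hkl hρ, hkl' hσ, hc⟩

theorem CompliantCH.sync_output_input {q : Bool} {l : List (ℕ × RC)} {z : ℕ × RC}
    {x y : Option RC} (h : CompliantCH [] x [] y) (hx : x ≠ some .one)
    (hxz : SameSteps x (some (.intSum [z]))) (hyl : SameSteps y (some (.ext q l))) :
    q = true ∧ ∃ σ, (z.1, σ) ∈ l ∧ Compliant z.2 σ := by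
  obtain ⟨r, a, _, _, _, _, h₁, h₂⟩ :=
    h.exists_sync hx (hxz.silent (silent_intSum_singleton _)) (hyl.silent (silent_ext _ _))
  obtain ⟨rfl, rfl⟩ := ((hxz _ _ _ _).1 h₁).act_of_intSum_singleton
  obtain ⟨rfl, σ, hσ⟩ := ((hyl _ _ _ _).1 h₂).act_of_ext
  obtain ⟨k, -, -, h₂⟩ := step_ext_of_mem (γ := []) true hσ
  have hc := h.of_fRed (.comm _ _ _ _ _ _ _ _ _ _
    ((hxz _ _ _ _).2 (.intOut _ _ _)) ((hyl _ _ _ _).2 h₂))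
  rcases hc.compliant_or with hc | hc
  · exact ⟨rfl, σ, hσ, hc⟩
  · exact absurd hc (not_compliantCH_none_left ((sameSteps_restOf _ _).silent (silent_ext _ _)))

theorem CompliantCH.sync_input_output {p : Bool} {l : List (ℕ × RC)} {z : ℕ × RC}
    {x y : Option RC} (h : CompliantCH [] x [] y) (hx : x ≠ some .one)
    (hxl : SameSteps x (some (.ext p l))) (hyz : SameSteps y (some (.intSum [z]))) :
    p = true ∧ ∃ ρ, (z.1, ρ) ∈ l ∧ Compliant ρ z.2 := by
  obtain ⟨r, a, _, _, _, _, h₁, h₂⟩ :=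
    h.exists_sync hx (hxl.silent (silent_ext _ _)) (hyz.silent (silent_intSum_singleton _))
  obtain ⟨rfl, ρ, hρ⟩ := ((hxl _ _ _ _).1 h₁).act_of_ext
  obtain ⟨hr, rfl⟩ := ((hyz _ _ _ _).1 h₂).act_of_intSum_singleton
  obtain rfl : r = true := by simpa using hr
  obtain ⟨k, -, -, h₁⟩ := step_ext_of_mem (γ := []) true hρ
  have hc := h.of_fRed (.comm _ _ _ _ _ _ _ _ _ _
    ((hxl _ _ _ _).2 h₁) ((hyz _ _ _ _).2 (.intOut _ _ _)))
  rcases hc.compliant_or with hc | hc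
  · exact ⟨rfl, ρ, hρ, hc⟩
  · exact absurd hc (not_compliantCH_none_right (restOf_ne_one _ _)
      ((sameSteps_restOf _ _).silent (silent_ext _ _)))

theorem CompliantCH.commit_left {ρ : RC} {x y : Option RC} (h : CompliantCH [] (some ρ) [] y)
    (hx : x = some ρ ∨ Step [] (some ρ) .tau [] x) : CompliantCH [] x [] y := by
  rcases hx with rfl | hx
  · exact h
  · exact h.of_fRed (.tauL _ _ _ _ _ _ hx)

theorem CompliantCH.commit_right {σ : RC} {x y : Option RC} (h : CompliantCH [] x [] (some σ))
    (hy : y = some σ ∨ Step [] (some σ) .tau [] y) : CompliantCH [] x [] y := by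
  rcases hy with rfl | hy
  · exact h
  · exact h.of_fRed (.tauR _ _ _ _ _ _ hy)

/-- Shapes of compliant contracts: if `ρ ⫤ σ` then (up to the
equi-recursive unfolding `Unf`) either ρ = 1, or both are dual retractable
sums with some compliant matching pair of continuations, or ρ is an
unretractable output whose names are all offered by the input sum σ with all
continuations compliant, or symmetrically. -/
theorem shapes_of_compliant_contracts (ρ σ : RC) (hρ : WF ρ) (hσ : WF σ)
    (h : Compliant ρ σ) :
    Unf ρ .one ∨
    (∃ (p : Bool) (lρ lσ : List (ℕ × RC)),
        Unf ρ (.ext p lρ) ∧ Unf σ (.ext (!p) lσ) ∧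
        ∃ (a : ℕ) (ρk σk : RC), (a, ρk) ∈ lρ ∧ (a, σk) ∈ lσ ∧ Compliant ρk σk) ∨
    (∃ lρ lσ : List (ℕ × RC),
        Unf ρ (.intSum lρ) ∧ Unf σ (.ext true lσ) ∧
        ∀ x ∈ lρ, ∃ σk : RC, (x.1, σk) ∈ lσ ∧ Compliant x.2 σk) ∨
    (∃ lρ lσ : List (ℕ × RC),
        Unf ρ (.ext true lρ) ∧ Unf σ (.intSum lσ) ∧
        ∀ x ∈ lσ, ∃ ρk : RC, (x.1, ρk) ∈ lρ ∧ Compliant ρk x.2) := by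
  rcases hρ.exists_unf with hρ | ⟨p, lρ, -, hρ⟩ | ⟨lρ, hneρ, hρ⟩
  · exact .inl hρ
  · have hne : some ρ ≠ some RC.one := by
      rintro ⟨⟩
      cases hρ
    rcases hσ.exists_unf with hσ | ⟨q, lσ, -, hσ⟩ | ⟨lσ, hneσ, hσ⟩
    · obtain ⟨_, _, _, _, _, _, _, h₂⟩ := h.exists_sync hne
        (hρ.sameSteps.silent (silent_ext _ _)) (hσ.sameSteps.silent silent_one)
      cases (hσ.sameSteps _ _ _ _).1 h₂
    · obtain ⟨rfl, hk⟩ := h.sync_retractable hne hρ.sameSteps hσ.sameSteps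
      exact .inr (.inl ⟨p, lρ, lσ, hρ, hσ, hk⟩)
    · have hk : ∀ z ∈ lσ, p = true ∧ ∃ ρk, (z.1, ρk) ∈ lρ ∧ Compliant ρk z.2 := by
        intro z hz
        obtain ⟨y, -, hy, hstep⟩ := hσ.exists_commit hz
        exact (h.commit_right hstep).sync_input_output hne hρ.sameSteps hy
      obtain ⟨z, hz⟩ := List.exists_mem_of_ne_nil _ hneσ
      obtain rfl := (hk z hz).1
      exact .inr (.inr (.inr ⟨lρ, lσ, hρ, hσ, fun z hz => (hk z hz).2⟩))
  · obtain ⟨z, hz⟩ := List.exists_mem_of_ne_nil _ hneρ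
    obtain ⟨x, hne, hx, hstep⟩ := hρ.exists_commit hz
    have hc := CompliantCH.commit_left h hstep
    rcases hσ.exists_unf with hσ | ⟨q, lσ, -, hσ⟩ | ⟨lσ, hneσ, hσ⟩
    · obtain ⟨_, _, _, _, _, _, _, h₂⟩ := hc.exists_sync hne
        (hx.silent (silent_intSum_singleton _)) (hσ.sameSteps.silent silent_one)
      cases (hσ.sameSteps _ _ _ _).1 h₂
    · obtain ⟨rfl, -⟩ := hc.sync_output_input hne hx hσ.sameSteps
      refine .inr (.inr (.inl ⟨lρ, lσ, hρ, hσ, fun z hz => ?_⟩))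
      obtain ⟨x, hne, hx, hstep⟩ := hρ.exists_commit hz
      exact ((CompliantCH.commit_left h hstep).sync_output_input hne hx hσ.sameSteps).2
    · obtain ⟨w, hw⟩ := List.exists_mem_of_ne_nil _ hneσ
      obtain ⟨y, -, hy, hstep⟩ := hσ.exists_commit hw
      obtain ⟨_, _, _, _, _, _, h₁, h₂⟩ := (hc.commit_right hstep).exists_sync hne
        (hx.silent (silent_intSum_singleton _)) (hy.silent (silent_intSum_singleton _))
      have h₁ := ((hx _ _ _ _).1 h₁).act_of_intSum_singleton.1
      have h₂ := ((hy _ _ _ _).1 h₂).act_of_intSum_singleton.1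
      simp [h₁] at h₂
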